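/- arXiv:1903.02381 — 4 statements merged into one kernel-verified Lean document; each statement's English description precedes it below -/
import Mathlib

section
/- If v ∈ ℝ^8 is a nonzero eigenvector of the adjacency matrix A of the E8 Dynkin diagram all of whose components are nonnegative, then v is an eigenvector for the eigenvalue 2cos(π/30), and v is a positive scalar multiple of the vector u = (2sinθ, 2sin2θ, 2sin3θ, 2sin4θ, 2sin5θ, sin2θ/sin3θ, sinθ/sin3θ, sinθ/sin2θ) with θ = π/30. -/
open Real

/-- The adjacency matrix of the E8 Dynkin diagram. -/
def E8adj : Matrix (Fin 8) (Fin 8) ℝ :=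
  !![0,1,0,0,0,0,0,0;
     1,0,1,0,0,0,0,0;
     0,1,0,1,0,0,0,0;
     0,0,1,0,1,0,0,0;
     0,0,0,1,0,1,0,1;
     0,0,0,0,1,0,1,0;
     0,0,0,0,0,1,0,0;
     0,0,0,0,1,0,0,0]

/-- The Perron–Frobenius vector of the adjacency matrix of the E8 Dynkin
diagram, with `θ = π/30`. -/
noncomputable def E8u : Fin 8 → ℝ :=
  ![2 * Real.sin (π / 30), 2 * Real.sin (2 * (π / 30)), 2 * Real.sin (3 * (π / 30)),
    2 * Real.sin (4 * (π / 30)), 2 * Real.sin (5 * (π / 30)),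
    Real.sin (2 * (π / 30)) / Real.sin (3 * (π / 30)),
    Real.sin (π / 30) / Real.sin (3 * (π / 30)),
    Real.sin (π / 30) / Real.sin (2 * (π / 30))]


theorem E8adj_transpose : E8adj.transpose = E8adj := by
  ext i j
  fin_cases i <;> fin_cases j <;> rfl

theorem E8adj_mulVec (w : Fin 8 → ℝ) :
    E8adj.mulVec w =
      ![w 1, w 0 + w 2, w 1 + w 3, w 2 + w 4, w 3 + w 5 + w 7, w 4 + w 6, w 5, w 4] := by
  ext i
  fin_cases i <;> simp [E8adj, Matrix.mulVec, dotProduct, Fin.sum_univ_eight]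

/-- A symmetric matrix with a positive eigenvector for `μ` has no nonzero nonnegative
eigenvector for any other eigenvalue. -/
theorem Matrix.eq_of_mulVec_eq_smul_of_pos {n : Type*} [Fintype n] {A : Matrix n n ℝ}
    (hA : A.transpose = A) {u v : n → ℝ} {μ lam : ℝ} (hu : ∀ i, 0 < u i)
    (hAu : A.mulVec u = μ • u) (hv : v ≠ 0) (hnn : ∀ i, 0 ≤ v i)
    (hAv : A.mulVec v = lam • v) : lam = μ := by
  have hpos : 0 < u ⬝ᵥ v := by
    obtain ⟨i, hi⟩ := Function.ne_iff.mp hv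
    exact Finset.sum_pos' (fun j _ => mul_nonneg (hu j).le (hnn j))
      ⟨i, Finset.mem_univ i, mul_pos (hu i) ((hnn i).lt_of_ne' hi)⟩
  have h : u ⬝ᵥ A.mulVec v = A.mulVec u ⬝ᵥ v := by
    rw [Matrix.dotProduct_mulVec, ← Matrix.mulVec_transpose, hA]
  rw [hAu, hAv, dotProduct_smul, smul_dotProduct, smul_eq_mul, smul_eq_mul] at h
  exact mul_right_cancel₀ hpos.ne' h

theorem sin_mul_pi_div_thirty_pos {k : ℝ} (hk : 0 < k) (hk' : k < 30) :
    0 < sin (k * (π / 30)) := by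
  apply sin_pos_of_pos_of_lt_pi
  · positivity
  · nlinarith [pi_pos]

theorem E8u_pos (i : Fin 8) : 0 < E8u i := by
  have h1 : 0 < sin (π / 30) := by
    simpa using sin_mul_pi_div_thirty_pos one_pos (by norm_num)
  have h2 : 0 < sin (2 * (π / 30)) := sin_mul_pi_div_thirty_pos (by norm_num) (by norm_num)
  have h3 : 0 < sin (3 * (π / 30)) := sin_mul_pi_div_thirty_pos (by norm_num) (by norm_num)
  have h4 : 0 < sin (4 * (π / 30)) := sin_mul_pi_div_thirty_pos (by norm_num) (by norm_num)
  have h5 : 0 < sin (5 * (π / 30)) := sin_mul_pi_div_thirty_pos (by norm_num) (by norm_num)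
  fin_cases i <;> simp [E8u] <;> positivity

theorem sqrt_three_lt_two_mul_cos_pi_div_thirty : √3 < 2 * cos (π / 30) := by
  have h : cos (π / 6) < cos (π / 30) :=
    cos_lt_cos_of_nonneg_of_le_pi (by positivity) (by linarith [pi_pos]) (by linarith [pi_pos])
  rw [cos_pi_div_six] at h
  linarith

theorem two_mul_sin_five_mul_pi_div_thirty : 2 * sin (5 * (π / 30)) = 1 := by
  rw [show 5 * (π / 30) = π / 6 by ring, sin_pi_div_six]
  norm_num

theorem cos_pi_div_thirty_identity :
    1 / 2 + cos (2 * (π / 30)) = cos (6 * (π / 30)) + cos (8 * (π / 30)) := by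
  have h : cos (2 * (π / 30)) - cos (8 * (π / 30)) = sin (3 * (π / 30)) := by
    rw [cos_sub_cos, show (2 * (π / 30) + 8 * (π / 30)) / 2 = 5 * (π / 30) by ring,
      show (2 * (π / 30) - 8 * (π / 30)) / 2 = -(3 * (π / 30)) by ring, sin_neg]
    linear_combination sin (3 * (π / 30)) * two_mul_sin_five_mul_pi_div_thirty
  have h3 : sin (3 * (π / 30)) = 2 * cos (π / 5) ^ 2 - 1 := by
    rw [← cos_two_mul, ← cos_pi_div_two_sub]
    ring_nf
  rw [show 6 * (π / 30) = π / 5 by ring]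
  rw [h3] at h
  rw [cos_pi_div_five] at h ⊢
  have h5 : √5 ^ 2 = 5 := sq_sqrt (by norm_num)
  linear_combination h + h5 / 8

theorem E8adj_mulVec_E8u : E8adj.mulVec E8u = (2 * cos (π / 30)) • E8u := by
  have h2 : sin (2 * (π / 30)) ≠ 0 :=
    (sin_mul_pi_div_thirty_pos (by norm_num) (by norm_num)).ne'
  have h3 : sin (3 * (π / 30)) ≠ 0 :=
    (sin_mul_pi_div_thirty_pos (by norm_num) (by norm_num)).ne'
  have h5 := two_mul_sin_five_mul_pi_div_thirty
  have hid := cos_pi_div_thirty_identity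
  have rec_sin (k : ℝ) : 2 * cos (π / 30) * sin (k * (π / 30)) =
      sin ((k - 1) * (π / 30)) + sin ((k + 1) * (π / 30)) := by
    rw [sub_mul, add_mul, one_mul, sin_sub, sin_add]
    ring
  have rec_cos (k : ℝ) : 2 * cos (π / 30) * cos (k * (π / 30)) =
      cos ((k - 1) * (π / 30)) + cos ((k + 1) * (π / 30)) := by
    rw [sub_mul, add_mul, one_mul, cos_sub, cos_add]
    ring
  have r1 := rec_sin 1
  have r2 := rec_sin 2
  have r3 := rec_sin 3
  have r4 := rec_sin 4
  have c1 := rec_cos 1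
  have c7 := rec_cos 7
  have hprod : 2 * sin (4 * (π / 30)) * sin (3 * (π / 30)) =
      cos (π / 30) - cos (7 * (π / 30)) := by
    rw [show π / 30 = 4 * (π / 30) - 3 * (π / 30) by ring,
      show 7 * (4 * (π / 30) - 3 * (π / 30)) = 4 * (π / 30) + 3 * (π / 30) by ring,
      cos_sub, cos_add]
    ring_nf
  norm_num at r1 r2 r3 r4 c1 c7
  rw [E8adj_mulVec]
  ext i
  fin_cases i <;> simp [E8u]
  · linear_combination -2 * r1
  · linear_combination -2 * r2
  · linear_combination -2 * r3
  · linear_combination -2 * r4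
  · have hC : 2 * cos (π / 30) * (sin (π / 30) / sin (2 * (π / 30))) = 1 := by
      rw [← mul_div_assoc (2 * cos (π / 30)), r1, div_self h2]
    have hD : sin (2 * (π / 30)) / sin (3 * (π / 30)) * sin (3 * (π / 30)) =
        sin (2 * (π / 30)) := div_mul_cancel₀ _ h3
    have hcos : 2 * cos (π / 30) ≠ 0 :=
      ((sqrt_nonneg 3).trans_lt sqrt_three_lt_two_mul_cos_pi_div_thirty).ne'
    apply mul_left_cancel₀ (mul_ne_zero hcos h3)
    linear_combination sin (3 * (π / 30)) * hC + 2 * cos (π / 30) * hD +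
      2 * cos (π / 30) * hprod + c1 - c7 + hid -
      (2 * cos (π / 30)) ^ 2 * sin (3 * (π / 30)) * h5 - 2 * cos (π / 30) * r3 - r4 - h5 / 2
  · rw [h5, ← mul_div_assoc (2 * cos (π / 30)), r2, add_div, div_self h3, add_comm]
  · rw [← mul_div_assoc (2 * cos (π / 30)), r1]
  · rw [h5, ← mul_div_assoc (2 * cos (π / 30)), r1, div_self h2]

theorem eq_zero_of_E8adj_mulVec_eq_smul {w : Fin 8 → ℝ} {μ : ℝ} (hμ : √3 < μ)
    (hw : E8adj.mulVec w = μ • w) (h0 : w 0 = 0) : w = 0 := by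
  have hμ3 : 3 < μ ^ 2 := (sqrt_lt' (by linarith [sqrt_nonneg 3])).mp hμ
  have hμ0 : μ ≠ 0 := by
    rintro rfl
    norm_num at hμ3
  rw [E8adj_mulVec] at hw
  have e (i) := congrFun hw i
  have e0 := e 0
  have e1 := e 1
  have e2 := e 2
  have e3 := e 3
  have e5 := e 5
  have e6 := e 6
  have e7 := e 7
  simp at e0 e1 e2 e3 e5 e6 e7
  have h1 : w 1 = 0 := by rw [e0, h0, mul_zero]
  have h2 : w 2 = 0 := by simpa [h0, h1] using e1
  have h3 : w 3 = 0 := by simpa [h1, h2] using e2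
  have h4 : w 4 = 0 := by simpa [h2, h3] using e3
  have h7 : w 7 = 0 := by simpa [h4, hμ0] using e7
  have h6 : w 6 = 0 := by
    have h : (μ ^ 2 - 1) * w 6 = 0 := by linear_combination -e5 + h4 - μ * e6
    exact (mul_eq_zero.mp h).resolve_left (by linarith)
  have h5 : w 5 = 0 := by rw [e6, h6, mul_zero]
  ext i
  fin_cases i <;> assumption

/-- A nonzero eigenvector of the E8 adjacency matrix with nonnegative
components is an eigenvector for the eigenvalue `2cos(π/30)` and is a
positive multiple of the Perron–Frobenius vector `u`. -/
theorem E8adj_nonneg_eigenvector (v : Fin 8 → ℝ) (lam : ℝ)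
    (hv : v ≠ 0) (hnn : ∀ i, 0 ≤ v i) (heig : E8adj.mulVec v = lam • v) :
    E8adj.mulVec v = (2 * Real.cos (π / 30)) • v ∧ ∃ c : ℝ, 0 < c ∧ v = c • E8u := by
  obtain rfl :=
    Matrix.eq_of_mulVec_eq_smul_of_pos E8adj_transpose E8u_pos E8adj_mulVec_E8u hv hnn heig
  have hvu : v = (v 0 / E8u 0) • E8u := by
    refine sub_eq_zero.mp
      (eq_zero_of_E8adj_mulVec_eq_smul sqrt_three_lt_two_mul_cos_pi_div_thirty ?_ ?_)
    · rw [Matrix.mulVec_sub, Matrix.mulVec_smul, heig, E8adj_mulVec_E8u, smul_sub, smul_comm]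
    · simp [(E8u_pos 0).ne']
  refine ⟨heig, v 0 / E8u 0, (div_nonneg (hnn 0) (E8u_pos 0).le).lt_of_ne' fun h => hv ?_, hvu⟩
  rw [hvu, h, zero_smul]
end

section
/- With θ = π/30 and u = (2sinθ, 2sin2θ, 2sin3θ, 2sin4θ, 2sin5θ, sin2θ/sin3θ, sinθ/sin3θ, sinθ/sin2θ), the four mass ratios u_7/u_1, u_6/u_2, u_5/u_3 and u_4/u_8 are all equal to the golden ratio r = (1 + √5)/2 = 2cos(π/5). -/
open Real

/-- The sine of `π / 10` is half the inverse of the golden ratio. -/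
theorem sin_three_mul_pi_div_thirty :
    Real.sin (3 * (π / 30)) = (Real.sqrt 5 - 1) / 4 := by
  have h5 : Real.sqrt 5 ^ 2 = 5 := Real.sq_sqrt (by norm_num)
  rw [show 3 * (π / 30) = π / 2 - 2 * (π / 5) by ring, Real.sin_pi_div_two_sub,
    Real.cos_two_mul, Real.cos_pi_div_five]
  linear_combination h5 / 8

theorem sin_five_mul_pi_div_thirty : Real.sin (5 * (π / 30)) = 1 / 2 := by
  rw [show 5 * (π / 30) = π / 6 by ring, Real.sin_pi_div_six]

theorem four_mul_sin_four_mul_cos (x : ℝ) :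
    4 * Real.sin (4 * x) * Real.cos x = 2 * (Real.sin (5 * x) + Real.sin (3 * x)) := by
  rw [show 5 * x = 4 * x + x by ring, show 3 * x = 4 * x - x by ring,
    Real.sin_add, Real.sin_sub]
  ring

/-- The four mass ratios `u_7/u_1`, `u_6/u_2`, `u_5/u_3`, `u_4/u_8` are all
equal to the golden ratio `r = (1 + √5)/2 = 2cos(π/5)`. -/
theorem E8u_golden_ratios :
    E8u 6 / E8u 0 = (1 + Real.sqrt 5) / 2 ∧
    E8u 5 / E8u 1 = (1 + Real.sqrt 5) / 2 ∧
    E8u 4 / E8u 2 = (1 + Real.sqrt 5) / 2 ∧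
    E8u 3 / E8u 7 = (1 + Real.sqrt 5) / 2 ∧
    (1 + Real.sqrt 5) / 2 = 2 * Real.cos (π / 5) := by
  have h5 : Real.sqrt 5 ^ 2 = 5 := Real.sq_sqrt (by norm_num)
  have hlt : 1 < Real.sqrt 5 := by rw [Real.lt_sqrt] <;> norm_num
  have hne : Real.sqrt 5 - 1 ≠ 0 := by linarith
  have h1 : Real.sin (π / 30) ≠ 0 :=
    (Real.sin_pos_of_pos_of_lt_pi (by positivity) (by linarith [Real.pi_pos])).ne'
  have h2 : Real.sin (2 * (π / 30)) ≠ 0 :=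
    (Real.sin_pos_of_pos_of_lt_pi (by positivity) (by linarith [Real.pi_pos])).ne'
  refine ⟨?_, ?_, ?_, ?_, ?_⟩
  · change Real.sin (π / 30) / Real.sin (3 * (π / 30)) / (2 * Real.sin (π / 30)) = _
    rw [sin_three_mul_pi_div_thirty]
    field_simp
    linear_combination -h5
  · change Real.sin (2 * (π / 30)) / Real.sin (3 * (π / 30)) /
      (2 * Real.sin (2 * (π / 30))) = _
    rw [sin_three_mul_pi_div_thirty]
    generalize Real.sin (2 * (π / 30)) = s at h2 ⊢
    field_simp
    linear_combination -h5
  · change 2 * Real.sin (5 * (π / 30)) / (2 * Real.sin (3 * (π / 30))) = _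
    rw [sin_three_mul_pi_div_thirty, sin_five_mul_pi_div_thirty]
    field_simp
    linear_combination -h5
  · change 2 * Real.sin (4 * (π / 30)) /
      (Real.sin (π / 30) / Real.sin (2 * (π / 30))) = _
    have h := four_mul_sin_four_mul_cos (π / 30)
    rw [sin_three_mul_pi_div_thirty, sin_five_mul_pi_div_thirty] at h
    rw [div_div_eq_mul_div, div_eq_iff h1, Real.sin_two_mul]
    linear_combination Real.sin (π / 30) * h
  · rw [Real.cos_pi_div_five]
    ring
end

section
/- 2sin(π/15) = (1/2)·√(7 − √5 − 2√3·√((5 − √5)/2)). -/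
open Real

theorem sin_pi_div_five_eq_sqrt : sin (π / 5) = √((5 - √5) / 2) / 2 := by
  have hpos : 0 ≤ sin (π / 5) :=
    sin_nonneg_of_nonneg_of_le_pi (by positivity) (by linarith [pi_pos])
  have hsq : (5 - √5) / 2 = (2 * sin (π / 5)) ^ 2 := by
    rw [mul_pow, sin_sq, cos_pi_div_five]
    linarith [Real.sq_sqrt (show (0 : ℝ) ≤ 5 by norm_num)]
  rw [hsq, sqrt_sq (by positivity)]
  ring

theorem cos_two_pi_div_fifteen :
    cos (2 * (π / 15)) = (1 + √5 + 2 * √3 * √((5 - √5) / 2)) / 8 := by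
  rw [show 2 * (π / 15) = π / 3 - π / 5 by ring, cos_sub, cos_pi_div_three,
    sin_pi_div_three, cos_pi_div_five, sin_pi_div_five_eq_sqrt]
  ring

/-- `2sin(π/15) = (1/2)·√(7 − √5 − 2√3·√((5 − √5)/2))`. -/
theorem two_sin_pi_div_fifteen :
    2 * Real.sin (π / 15) =
      (1 / 2) * Real.sqrt (7 - Real.sqrt 5 -
        2 * Real.sqrt 3 * Real.sqrt ((5 - Real.sqrt 5) / 2)) := by
  have hpos : 0 ≤ sin (π / 15) :=
    sin_nonneg_of_nonneg_of_le_pi (by positivity) (by linarith [pi_pos])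
  have hsq : 7 - √5 - 2 * √3 * √((5 - √5) / 2) = (4 * sin (π / 15)) ^ 2 := by
    rw [mul_pow, sin_sq_eq_half_sub, cos_two_pi_div_fifteen]
    ring
  rw [hsq, sqrt_sq (by positivity)]
  ring
end

section
/- 2sin(π/30) = (1/2)·√(9 − √5 − 2√3·√((5 + √5)/2)). -/
open Real

theorem cos_two_pi_div_five : Real.cos (2 * (π / 5)) = (√5 - 1) / 4 := by
  rw [Real.cos_two_mul, Real.cos_pi_div_five]
  linear_combination (1 / 8) * Real.sq_sqrt (show (0 : ℝ) ≤ 5 by norm_num)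

theorem sin_two_pi_div_five : Real.sin (2 * (π / 5)) = √((5 + √5) / 2) / 2 := by
  have hsin : 0 ≤ Real.sin (2 * (π / 5)) :=
    Real.sin_nonneg_of_nonneg_of_le_pi (by positivity) (by linarith [Real.pi_pos])
  rw [← sq_eq_sq₀ hsin (by positivity), Real.sin_sq, cos_two_pi_div_five, div_pow √_,
    Real.sq_sqrt (by positivity)]
  linear_combination (-1 / 16) * Real.sq_sqrt (show (0 : ℝ) ≤ 5 by norm_num)

theorem cos_pi_div_fifteen :
    Real.cos (π / 15) = (√5 - 1 + 2 * √3 * √((5 + √5) / 2)) / 8 := by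
  rw [show π / 15 = 2 * (π / 5) - π / 3 by ring, Real.cos_sub, cos_two_pi_div_five,
    sin_two_pi_div_five, Real.cos_pi_div_three, Real.sin_pi_div_three]
  ring

/-- `2sin(π/30) = (1/2)·√(9 − √5 − 2√3·√((5 + √5)/2))`. -/
theorem two_sin_pi_div_thirty :
    2 * Real.sin (π / 30) =
      (1 / 2) * Real.sqrt (9 - Real.sqrt 5 -
        2 * Real.sqrt 3 * Real.sqrt ((5 + Real.sqrt 5) / 2)) := by
  have hsin : 0 ≤ Real.sin (π / 30) :=
    Real.sin_nonneg_of_nonneg_of_le_pi (by positivity) (by linarith [Real.pi_pos])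
  have hsq : 9 - √5 - 2 * √3 * √((5 + √5) / 2) = (4 * Real.sin (π / 30)) ^ 2 := by
    rw [mul_pow, Real.sin_sq_eq_half_sub, show 2 * (π / 30) = π / 15 by ring,
      cos_pi_div_fifteen]
    ring
  rw [hsq, Real.sqrt_sq (by positivity)]
  ring
end
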